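/- Let ℬ be a C-s-w-semi-greedy Markushevich basis of 𝕏 (C > 0, 0 < s ≤ 1), suppose the weight w = (w_i) has a subsequence (w_{i_k})_{k∈ℕ} with inf_k w_{i_k} > 0, and suppose the corresponding subsequence (x_{i_k})_{k∈ℕ} of ℬ has the FDSP with constant M. Then for every x ∈ 𝕏, every finite A ⊂ ℕ and every ε ∈ E_A, if w(A) ≤ w({i ∈ ℕ : |x_i*(x)| ≥ 1}), then ‖1_{ε,A}‖ ≤ 2s⁻¹·C·M·max{λλ′, 2s⁻²C}·‖x‖. Consequently, ℬ is w-superdemocratic and truncation quasi-greedy, in each case with constant 2s⁻¹·C·M·max{λλ′, 2s⁻²C}. -/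

import Mathlib

open scoped BigOperators ENNReal
open Filter

noncomputable section

namespace GreedyPaper

variable {𝕜 : Type*} [RCLike 𝕜] {X : Type*} [NormedAddCommGroup X] [NormedSpace 𝕜 X]

/-- Support of `x` with respect to the coordinate functionals `f`. -/
def msupp (f : ℕ → X →L[𝕜] 𝕜) (x : X) : Set ℕ := {i | f i x ≠ 0}

/-- Projection onto a finite set of coordinates. -/
def proj (e : ℕ → X) (f : ℕ → X →L[𝕜] 𝕜) (A : Finset ℕ) (x : X) : X :=
  ∑ i ∈ A, f i x • e i

/-- `A` is an `m`-`t`-greedy set for `x`: `|A| = m` and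
`min_{j ∈ A} |f j x| ≥ t · sup_{k ∉ A} |f k x|`. -/
def GreedySet (f : ℕ → X →L[𝕜] 𝕜) (x : X) (m : ℕ) (t : ℝ) (A : Finset ℕ) : Prop :=
  A.card = m ∧ ∀ j ∈ A, ∀ k ∉ A, t * ‖f k x‖ ≤ ‖f j x‖

/-- `w`-measure of a set of indices, with value in `ℝ≥0∞` (possibly infinite). -/
def wsum (w : ℕ → ℝ) (S : Set ℕ) : ℝ≥0∞ := ∑' i : S, ENNReal.ofReal (w i)

/-- Sign of a scalar: `sgn 0 = 1` and `sgn t * t = |t|`. -/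
def sgn (t : 𝕜) : 𝕜 := if t = 0 then 1 else (‖t‖ : 𝕜) / t

/-- A Markushevich basis (with the boundedness assumptions of the paper):
biorthogonality, dense span, totality of the coordinate functionals, and boundedness
of both the basis vectors and the coordinate functionals. -/
structure IsMarkushevichBasis (e : ℕ → X) (f : ℕ → X →L[𝕜] 𝕜) : Prop where
  biorth : ∀ i j, f i (e j) = if i = j then 1 else 0
  dense_span : Dense ((Submodule.span 𝕜 (Set.range e) : Submodule 𝕜 X) : Set X)
  total : ∀ x : X, (∀ i, f i x = 0) → x = 0
  bddE : BddAbove (Set.range fun i => ‖e i‖)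
  bddF : BddAbove (Set.range fun i => ‖f i‖)

/-- `ℬ` is `C`-`s`-`w`-semi-greedy: for every `x` and `m` there are an `m`-`s`-greedy set `A`
and `y` supported in `A` with `‖x - y‖ ≤ C · inf {‖x - z‖ : supp z finite, w(supp z) ≤ w(A)}`. -/
def SemiGreedy (e : ℕ → X) (f : ℕ → X →L[𝕜] 𝕜) (w : ℕ → ℝ) (C s : ℝ) : Prop :=
  ∀ (x : X) (m : ℕ), ∃ A : Finset ℕ, GreedySet f x m s A ∧
    ∃ y : X, msupp f y ⊆ (A : Set ℕ) ∧
      ∀ z : X, (msupp f z).Finite → wsum w (msupp f z) ≤ wsum w (A : Set ℕ) →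
        ‖x - y‖ ≤ C * ‖x - z‖

/-- `ℬ` is `C`-`s`-`w`-almost semi-greedy. -/
def AlmostSemiGreedy (e : ℕ → X) (f : ℕ → X →L[𝕜] 𝕜) (w : ℕ → ℝ) (C s : ℝ) : Prop :=
  ∀ (x : X) (m : ℕ), ∃ A : Finset ℕ, GreedySet f x m s A ∧
    ∃ y : X, msupp f y ⊆ (A : Set ℕ) ∧
      ∀ B : Finset ℕ, wsum w (B : Set ℕ) ≤ wsum w (A : Set ℕ) →
        ‖x - y‖ ≤ C * ‖x - proj e f B x‖

/-- `ℬ` is `C`-`w`-almost greedy. -/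
def AlmostGreedy (e : ℕ → X) (f : ℕ → X →L[𝕜] 𝕜) (w : ℕ → ℝ) (C : ℝ) : Prop :=
  ∀ (x : X) (m : ℕ) (A : Finset ℕ), GreedySet f x m 1 A →
    ∀ B : Finset ℕ, wsum w (B : Set ℕ) ≤ wsum w (A : Set ℕ) →
      ‖x - proj e f A x‖ ≤ C * ‖x - proj e f B x‖

/-- `ℬ` is `C`-`w`-disjoint almost greedy. -/
def DisjointAlmostGreedy (e : ℕ → X) (f : ℕ → X →L[𝕜] 𝕜) (w : ℕ → ℝ) (C : ℝ) : Prop :=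
  ∀ (x : X) (m : ℕ) (A : Finset ℕ), GreedySet f x m 1 A →
    ∀ B : Finset ℕ, wsum w (B : Set ℕ) ≤ wsum w (A : Set ℕ) → Disjoint B A →
      ‖x - proj e f A x‖ ≤ C * ‖x - proj e f B x‖

/-- `ℬ` is `C`-`s`-`w`-almost greedy in the weak sense. -/
def WeakAlmostGreedy (e : ℕ → X) (f : ℕ → X →L[𝕜] 𝕜) (w : ℕ → ℝ) (C s : ℝ) : Prop :=
  ∀ (x : X) (m : ℕ), ∃ A : Finset ℕ, GreedySet f x m s A ∧
    ∀ B : Finset ℕ, wsum w (B : Set ℕ) ≤ wsum w (A : Set ℕ) →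
      ‖x - proj e f A x‖ ≤ C * ‖x - proj e f B x‖

/-- `ℬ` is `C`-`w`-superdemocratic. -/
def SuperDemocratic (e : ℕ → X) (f : ℕ → X →L[𝕜] 𝕜) (w : ℕ → ℝ) (C : ℝ) : Prop :=
  ∀ (A B : Finset ℕ) (ε ε' : ℕ → 𝕜), (∀ i ∈ A, ‖ε i‖ = 1) → (∀ i ∈ B, ‖ε' i‖ = 1) →
    wsum w (A : Set ℕ) ≤ wsum w (B : Set ℕ) →
      ‖∑ i ∈ A, ε i • e i‖ ≤ C * ‖∑ i ∈ B, ε' i • e i‖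

/-- `ℬ` is `C`-`w`-democratic. -/
def Democratic (e : ℕ → X) (f : ℕ → X →L[𝕜] 𝕜) (w : ℕ → ℝ) (C : ℝ) : Prop :=
  ∀ A B : Finset ℕ, wsum w (A : Set ℕ) ≤ wsum w (B : Set ℕ) →
    ‖∑ i ∈ A, e i‖ ≤ C * ‖∑ i ∈ B, e i‖

/-- `ℬ` is `C`-truncation quasi-greedy. -/
def TruncationQuasiGreedy (e : ℕ → X) (f : ℕ → X →L[𝕜] 𝕜) (C : ℝ) : Prop :=
  ∀ (x : X) (m : ℕ) (A : Finset ℕ) (hA : A.Nonempty), GreedySet f x m 1 A →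
    (A.inf' hA fun i => ‖f i x‖) * ‖∑ i ∈ A, sgn (f i x) • e i‖ ≤ C * ‖x‖

/-- `ℬ` has the `C`-`w`-Property (A). -/
def PropertyA (e : ℕ → X) (f : ℕ → X →L[𝕜] 𝕜) (w : ℕ → ℝ) (C : ℝ) : Prop :=
  ∀ x : X, (∀ i, ‖f i x‖ ≤ 1) →
    ∀ A B : Finset ℕ, wsum w (A : Set ℕ) ≤ wsum w (B : Set ℕ) → Disjoint A B →
      (∀ i ∈ A ∪ B, f i x = 0) →
      ∀ ε ε' : ℕ → 𝕜, (∀ i ∈ A, ‖ε i‖ = 1) → (∀ i ∈ B, ‖ε' i‖ = 1) →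
        ‖x + ∑ i ∈ A, ε i • e i‖ ≤ C * ‖x + ∑ i ∈ B, ε' i • e i‖

/-- The finite dimensional separation property (FDSP) with constant `M`. -/
def FDSP (e : ℕ → X) (M : ℝ) : Prop :=
  ∀ Z : Submodule 𝕜 X, IsClosed (Z : Set X) → TopologicalSpace.IsSeparable (Z : Set X) →
    ∀ ε : ℝ, 0 < ε → ∃ k : ℕ → ℕ, StrictMono k ∧
      (∀ (a : ℕ → 𝕜) (n l : ℕ), n ≤ l →
        ‖∑ j ∈ Finset.range (n + 1), a j • e (k j)‖ ≤
          (M + ε) * ‖∑ j ∈ Finset.range (l + 1), a j • e (k j)‖) ∧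
      (∀ F : Submodule 𝕜 X, F ≤ Z → FiniteDimensional 𝕜 F →
        ∃ N : ℕ, ∀ x ∈ F,
          ∀ z ∈ closure ((Submodule.span 𝕜 {v : X | ∃ n, N < n ∧ v = e (k n)} :
              Submodule 𝕜 X) : Set X),
            ‖x‖ ≤ (M + ε) * ‖x + z‖)

/-- `v` is a block basis of `e`. -/
def IsBlockBasis (e v : ℕ → X) : Prop :=
  ∃ (b : ℕ → 𝕜) (n m : ℕ → ℕ), (∀ i, n i ≤ m i) ∧ (∀ i, m i < n (i + 1)) ∧
    (∀ i, v i = ∑ k ∈ Finset.Icc (n i) (m i), b k • e k) ∧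
    (∀ i, ∃ k ∈ Finset.Icc (n i) (m i), b k ≠ 0)

lemma wsum_coe {w : ℕ → ℝ} (hw : ∀ i, 0 < w i) (A : Finset ℕ) :
    wsum w (A : Set ℕ) = ENNReal.ofReal (∑ i ∈ A, w i) := by
  rw [wsum, ENNReal.ofReal_sum_of_nonneg fun i _ => (hw i).le]
  exact Finset.tsum_subtype A fun i => ENNReal.ofReal (w i)

lemma wsum_coe_le_iff {w : ℕ → ℝ} (hw : ∀ i, 0 < w i) (A B : Finset ℕ) :
    wsum w (A : Set ℕ) ≤ wsum w (B : Set ℕ) ↔ ∑ i ∈ A, w i ≤ ∑ i ∈ B, w i := by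
  rw [wsum_coe hw, wsum_coe hw,
    ENNReal.ofReal_le_ofReal_iff (Finset.sum_nonneg fun i _ => (hw i).le)]

lemma wsum_mono {w : ℕ → ℝ} {S T : Set ℕ} (h : S ⊆ T) : wsum w S ≤ wsum w T :=
  ENNReal.tsum_mono_subtype (fun i => ENNReal.ofReal (w i)) h

lemma norm_sgn (t : 𝕜) : ‖sgn t‖ = 1 := by
  unfold sgn
  split_ifs with h
  · simp
  · simp [h]

namespace IsMarkushevichBasis

variable {e : ℕ → X} {f : ℕ → X →L[𝕜] 𝕜}

lemma coord_sum (h : IsMarkushevichBasis e f) (A : Finset ℕ) (a : ℕ → 𝕜) (j : ℕ) :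
    f j (∑ i ∈ A, a i • e i) = if j ∈ A then a j else 0 := by
  simp [map_sum, h.biorth]

lemma eq_sum_of_msupp_subset (h : IsMarkushevichBasis e f) {y : X} {G : Finset ℕ}
    (hy : msupp f y ⊆ (G : Set ℕ)) : y = ∑ i ∈ G, f i y • e i := by
  rw [← sub_eq_zero]
  refine h.total _ fun j => ?_
  rw [map_sub, h.coord_sum G fun i => f i y]
  split_ifs with hj
  · simp
  · have : f j y = 0 := by
      by_contra hne
      exact hj (hy hne)
    simp [this]

lemma mem_span_of_msupp_subset (h : IsMarkushevichBasis e f) {y : X} {G : Finset ℕ} {S : Set ℕ}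
    (hy : msupp f y ⊆ (G : Set ℕ)) (hG : (G : Set ℕ) ⊆ S) :
    y ∈ Submodule.span 𝕜 (e '' S) := by
  rw [h.eq_sum_of_msupp_subset hy]
  exact Submodule.sum_mem _ fun i hi =>
    Submodule.smul_mem _ _ (Submodule.subset_span ⟨i, hG hi, rfl⟩)

lemma norm_e_le (h : IsMarkushevichBasis e f) (i : ℕ) : ‖e i‖ ≤ ⨆ i, ‖e i‖ := le_ciSup h.bddE i

lemma norm_f_le (h : IsMarkushevichBasis e f) (i : ℕ) : ‖f i‖ ≤ ⨆ i, ‖f i‖ := le_ciSup h.bddF i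

lemma finite_coord_ge (h : IsMarkushevichBasis e f) (x : X) {r : ℝ} (hr : 0 < r) :
    {i | r ≤ ‖f i x‖}.Finite := by
  set L := ⨆ i, ‖f i‖ with hL
  have hL0 : 0 ≤ L := (norm_nonneg _).trans (h.norm_f_le 0)
  obtain ⟨y, hy, hxy⟩ := Metric.mem_closure_iff.1 (h.dense_span x) (r / (L + 1)) (by positivity)
  have hfin : {i | f i y ≠ 0}.Finite := by
    clear hxy
    induction hy using Submodule.span_induction with
    | mem v hv =>
      obtain ⟨j, rfl⟩ := hv
      refine (Set.finite_singleton j).subset fun i hi => ?_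
      by_contra hij
      exact hi (by rw [h.biorth, if_neg (by simpa using hij)])
    | zero => simp
    | add u v _ _ hu hv =>
      refine (hu.union hv).subset fun i hi => ?_
      by_contra hcon
      simp only [Set.mem_union, Set.mem_ofPred_eq, not_or, not_not] at hcon
      exact hi (by simp [hcon.1, hcon.2])
    | smul a v _ hv =>
      refine hv.subset fun i hi => ?_
      intro hcon
      exact hi (by simp [hcon])
  refine hfin.subset fun i hi hcon => ?_
  have hi' : r ≤ ‖f i x‖ := hi
  have h1 : ‖f i x‖ ≤ L * ‖x - y‖ := by
    calc ‖f i x‖ = ‖f i (x - y)‖ := by rw [map_sub, hcon, sub_zero]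
      _ ≤ ‖f i‖ * ‖x - y‖ := (f i).le_opNorm _
      _ ≤ L * ‖x - y‖ := by gcongr; exact h.norm_f_le i
  rw [dist_eq_norm, lt_div_iff₀ (by positivity)] at hxy
  nlinarith [norm_nonneg (x - y)]

end IsMarkushevichBasis

/-- A maximal finite subset of weight at most `W`, together with one further index that makes
the weight reach `W`. -/
lemma exists_block {w : ℕ → ℝ} {S : Set ℕ} (hS : S.Infinite) {c : ℝ} (hc : 0 < c)
    (hcw : ∀ i ∈ S, c ≤ w i) {W : ℝ} (hW : 0 ≤ W) (T : Finset ℕ) :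
    ∃ (D : Finset ℕ) (d : ℕ), (D : Set ℕ) ⊆ S ∧ d ∈ S ∧ d ∉ D ∧ Disjoint D T ∧ d ∉ T ∧
      ∑ i ∈ D, w i ≤ W ∧ W ≤ ∑ i ∈ D, w i + w d ∧ c * D.card ≤ W := by
  have hcard : ∀ D : Finset ℕ, (D : Set ℕ) ⊆ S → ∑ i ∈ D, w i ≤ W → c * D.card ≤ W := by
    intro D hD hDW
    have := Finset.card_nsmul_le_sum D w c fun i hi => hcw i (hD hi)
    rw [nsmul_eq_mul] at this
    linarith
  by_contra hcon
  have key : ∀ n : ℕ, ∃ D : Finset ℕ, (D : Set ℕ) ⊆ S ∧ Disjoint D T ∧ D.card = n ∧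
      ∑ i ∈ D, w i ≤ W := by
    intro n
    induction n with
    | zero => exact ⟨∅, by simp, by simp, rfl, by simpa using hW⟩
    | succ n ih =>
      obtain ⟨D, hD, hDT, hn, hDW⟩ := ih
      obtain ⟨d, hd, hdn⟩ := hS.exists_notMem_finset (D ∪ T)
      rw [Finset.mem_union, not_or] at hdn
      by_cases hle : ∑ i ∈ D, w i + w d ≤ W
      · refine ⟨insert d D, ?_, ?_, ?_, ?_⟩
        · rw [Finset.coe_insert]
          exact Set.insert_subset hd hD
        · exact Finset.disjoint_insert_left.2 ⟨hdn.2, hDT⟩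
        · rw [Finset.card_insert_of_notMem hdn.1, hn]
        · rw [Finset.sum_insert hdn.1]
          linarith
      · exact (hcon ⟨D, d, hD, hd, hdn.1, hDT, hdn.2, hDW, (not_le.1 hle).le,
          hcard D hD hDW⟩).elim
  obtain ⟨n, hn⟩ := exists_nat_gt (W / c)
  obtain ⟨D, hD, -, hDn, hDW⟩ := key n
  have := hcard D hD hDW
  rw [div_lt_iff₀ hc, ← hDn] at hn
  linarith

section

variable {e : ℕ → X} {f : ℕ → X →L[𝕜] 𝕜} {w : ℕ → ℝ} {C s : ℝ}

/-- Approximating `1_{ε,A}` plus a dominating block on `E` by vectors supported in `E`. -/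
lemma SemiGreedy.exists_approx_dominating (hsg : SemiGreedy e f w C s)
    (h : IsMarkushevichBasis e f) (hw : ∀ i, 0 < w i) (hs0 : 0 < s)
    {A E : Finset ℕ} (hAE : Disjoint A E) {ε η : ℕ → 𝕜}
    (hε : ∀ i ∈ A, ‖ε i‖ = 1) (hη : ∀ i ∈ E, ‖η i‖ = 1)
    (hwAE : ∑ i ∈ A, w i ≤ ∑ i ∈ E, w i) {τ : ℝ} (hτ : s⁻¹ < τ) :
    ∃ y ∈ Submodule.span 𝕜 (e '' (E : Set ℕ)),
      ‖∑ i ∈ A, ε i • e i + (τ : 𝕜) • ∑ i ∈ E, η i • e i - y‖ ≤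
        C * (τ * ‖∑ i ∈ E, η i • e i‖) := by
  have hτ0 : 0 < τ := (inv_pos.2 hs0).trans hτ
  have hsτ : 1 < s * τ := by
    rw [inv_lt_iff_one_lt_mul₀ hs0] at hτ
    linarith
  set v := ∑ i ∈ A, ε i • e i + (τ : 𝕜) • ∑ i ∈ E, η i • e i with hv
  have hvE : ∀ j ∈ E, ‖f j v‖ = τ := by
    intro j hj
    have hjA : j ∉ A := fun hjA => Finset.disjoint_left.1 hAE hjA hj
    rw [hv, map_add, map_smul, h.coord_sum, h.coord_sum, if_neg hjA, if_pos hj, zero_add,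
      norm_smul, hη j hj, mul_one, RCLike.norm_of_nonneg hτ0.le]
  have hvn : ∀ j ∉ E, ‖f j v‖ ≤ 1 := by
    intro j hj
    rw [hv, map_add, map_smul, h.coord_sum, h.coord_sum, if_neg hj, smul_zero, add_zero]
    split_ifs with hjA
    · exact (hε j hjA).le
    · simp
  obtain ⟨G, ⟨hGc, hG⟩, y, hy, hbest⟩ := hsg v E.card
  have hEG : E ⊆ G := by
    intro k hk
    by_contra hkG
    have hGE : G ⊆ E := by
      intro j hj
      by_contra hjE
      have h1 := hG j hj k hkG
      rw [hvE k hk] at h1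
      linarith [hvn j hjE]
    exact hkG (Finset.eq_of_subset_of_card_le hGE hGc.ge ▸ hk)
  obtain rfl : E = G := Finset.eq_of_subset_of_card_le hEG hGc.le
  refine ⟨y, h.mem_span_of_msupp_subset hy subset_rfl, ?_⟩
  have hsupp : msupp f (∑ i ∈ A, ε i • e i) ⊆ (A : Set ℕ) := by
    intro j hj
    by_contra hjA
    exact hj (by rw [h.coord_sum, if_neg (by simpa using hjA)])
  have := hbest (∑ i ∈ A, ε i • e i) (A.finite_toSet.subset hsupp)
    ((wsum_mono hsupp).trans ((wsum_coe_le_iff hw A E).2 hwAE))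
  rwa [hv, add_sub_cancel_left, norm_smul, RCLike.norm_of_nonneg hτ0.le, ← hv] at this

/-- Approximating `x` plus a small block on `D` by vectors supported on the large coordinates
of `x`. -/
lemma SemiGreedy.exists_approx_small (hsg : SemiGreedy e f w C s)
    (h : IsMarkushevichBasis e f) (hs0 : 0 < s) (hs1 : s ≤ 1)
    (x : X) {D : Finset ℕ} {t : ℝ} (ht : 0 < t) (hD : ∀ i ∈ D, ‖f i x‖ < s ^ 2 - t)
    (hwD : wsum w (D : Set ℕ) ≤ wsum w {i | 1 ≤ ‖f i x‖}) :
    ∃ y ∈ Submodule.span 𝕜 (e '' {i | s ^ 2 ≤ ‖f i x‖}),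
      ‖x + (t : 𝕜) • ∑ i ∈ D, e i - y‖ ≤ C * ‖x‖ := by
  have hss : s ^ 2 ≤ s := by nlinarith
  set u := x + (t : 𝕜) • ∑ i ∈ D, e i with hu
  have hcs : ∀ j, f j (∑ i ∈ D, e i) = if j ∈ D then 1 else 0 := by
    intro j
    simpa using h.coord_sum D (fun _ => 1) j
  have huD : ∀ j ∈ D, ‖f j u‖ < s ^ 2 := by
    intro j hj
    have h1 : f j u = f j x + (t : 𝕜) := by
      rw [hu, map_add, map_smul, hcs, if_pos hj, smul_eq_mul, mul_one]
    rw [h1]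
    have h2 := norm_add_le (f j x) (t : 𝕜)
    rw [RCLike.norm_of_nonneg ht.le] at h2
    linarith [hD j hj]
  have hun : ∀ j ∉ D, f j u = f j x := by
    intro j hj
    rw [hu, map_add, map_smul, hcs, if_neg hj, smul_zero, add_zero]
  have hxD : ∀ j, s ^ 2 ≤ ‖f j x‖ → f j u = f j x := fun j hj =>
    hun j fun hjD => by linarith [hD j hjD]
  have huge : ∀ j, s ^ 2 ≤ ‖f j u‖ → f j u = f j x := fun j hj =>
    hun j fun hjD => by linarith [huD j hjD]
  set Bs := (h.finite_coord_ge x hs0).toFinset with hBs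
  have hmem : ∀ j, j ∈ Bs ↔ s ≤ ‖f j x‖ := by simp [hBs]
  obtain ⟨G, ⟨hGc, hG⟩, y, hy, hbest⟩ := hsg u Bs.card
  have hG2 : (G : Set ℕ) ⊆ {i | s ^ 2 ≤ ‖f i x‖} := by
    by_cases hBG : Bs ⊆ G
    · rw [← Finset.eq_of_subset_of_card_le hBG hGc.le]
      intro j hj
      exact hss.trans ((hmem j).1 hj)
    · obtain ⟨k, hk, hkG⟩ := Finset.not_subset.1 hBG
      intro j hj
      have h1 := hG j hj k hkG
      rw [hmem] at hk
      rw [hxD k (hss.trans hk)] at h1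
      have h2 : s ^ 2 ≤ ‖f j u‖ := by nlinarith
      rwa [huge j h2] at h2
  have hBG : {i | 1 ≤ ‖f i x‖} ⊆ (G : Set ℕ) := by
    intro k hk
    by_contra hkG
    have hk : 1 ≤ ‖f k x‖ := hk
    have hGB : G ⊆ Bs := by
      intro j hj
      have h1 := hG j hj k hkG
      rw [hxD k (by linarith)] at h1
      have h2 : s ≤ ‖f j u‖ := by nlinarith
      rw [hmem]
      rwa [huge j (hss.trans h2)] at h2
    have hGe : G = Bs := Finset.eq_of_subset_of_card_le hGB hGc.ge
    exact hkG (by rw [hGe]; exact (hmem k).2 (hs1.trans hk))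
  refine ⟨y, h.mem_span_of_msupp_subset hy hG2, ?_⟩
  have hsupp : msupp f ((t : 𝕜) • ∑ i ∈ D, e i) ⊆ (D : Set ℕ) := by
    intro j hj
    by_contra hjD
    exact hj (by rw [map_smul, hcs, if_neg (by simpa using hjD), smul_zero])
  have := hbest ((t : 𝕜) • ∑ i ∈ D, e i) (D.finite_toSet.subset hsupp)
    ((wsum_mono hsupp).trans (hwD.trans (wsum_mono hBG)))
  rwa [hu, add_sub_cancel_right, ← hu] at this

/-- Two disjoint blocks inside an infinite set `S` whose indicator vectors nearly differ by at
most `2C‖x‖/t`. -/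
lemma SemiGreedy.exists_close_blocks (hsg : SemiGreedy e f w C s)
    (h : IsMarkushevichBasis e f) (hw : ∀ i, 0 < w i) (hs0 : 0 < s) (hs1 : s ≤ 1)
    (x : X) {t : ℝ} (ht : 0 < t) (hts : t < s ^ 2)
    {S : Set ℕ} (hS : S.Infinite) {c : ℝ} (hc : 0 < c) (hcw : ∀ i ∈ S, c ≤ w i)
    {W : ℝ} (hW : 0 ≤ W) (hWx : ENNReal.ofReal W ≤ wsum w {i | 1 ≤ ‖f i x‖})
    (T : Finset ℕ) {δ : ℝ} (hδ : 0 < δ) :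
    ∃ (D D' : Finset ℕ) (d : ℕ), (D : Set ℕ) ⊆ S ∧ (D' : Set ℕ) ⊆ S ∧ d ∈ S ∧
      d ∉ D ∧ d ∉ D' ∧ Disjoint D D' ∧ Disjoint D T ∧ Disjoint D' T ∧ d ∉ T ∧
      W ≤ ∑ i ∈ D, w i + w d ∧
      t * ‖∑ i ∈ D, e i - ∑ i ∈ D', e i‖ ≤ 2 * (C * ‖x‖) + δ := by
  set L := ⨆ i, ‖e i‖ with hL
  set R := (h.finite_coord_ge x (sub_pos.2 hts)).toFinset with hR
  have hblock := fun n : ℕ => exists_block hS hc hcw hW (T ∪ R ∪ Finset.range n)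
  choose D d hDS hdS hdD hDT hdT hDW hWD hcard using hblock
  simp only [Finset.disjoint_union_right, Finset.mem_union, not_or] at hDT hdT
  have happ := fun n => hsg.exists_approx_small h hs0 hs1 x (D := D n) ht
    (fun i hi => by
      by_contra hcon
      exact Finset.disjoint_left.1 (hDT n).1.2 hi (by simpa [hR] using hcon))
    ((by rw [wsum_coe hw]; exact ENNReal.ofReal_le_ofReal (hDW n) :
      wsum w (D n : Set ℕ) ≤ ENNReal.ofReal W).trans hWx)
  choose y hyV hy using happ
  have : FiniteDimensional 𝕜 (Submodule.span 𝕜 (e '' {i | s ^ 2 ≤ ‖f i x‖})) :=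
    FiniteDimensional.span_of_finite 𝕜 ((h.finite_coord_ge x (by positivity)).image e)
  have : ProperSpace (Submodule.span 𝕜 (e '' {i | s ^ 2 ≤ ‖f i x‖})) :=
    FiniteDimensional.proper 𝕜 _
  have hL0 : 0 ≤ L := (norm_nonneg _).trans (h.norm_e_le 0)
  have hsumD : ∀ n, ‖∑ i ∈ D n, e i‖ ≤ W / c * L := by
    intro n
    have h1 : ((D n).card : ℝ) ≤ W / c := by
      rw [le_div_iff₀ hc]
      linarith [hcard n]
    calc ‖∑ i ∈ D n, e i‖ ≤ ∑ i ∈ D n, ‖e i‖ := norm_sum_le _ _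
      _ ≤ (D n).card • L := Finset.sum_le_card_nsmul _ _ _ fun i _ => h.norm_e_le i
      _ ≤ W / c * L := by rw [nsmul_eq_mul]; gcongr
  have htn : ∀ v : X, ‖(t : 𝕜) • v‖ = t * ‖v‖ := fun v => by
    rw [norm_smul, RCLike.norm_of_nonneg ht.le]
  have hbd : ∀ n, (⟨y n, hyV n⟩ : Submodule.span 𝕜 (e '' {i | s ^ 2 ≤ ‖f i x‖})) ∈
      Metric.closedBall 0 (‖x‖ + t * (W / c * L) + C * ‖x‖) := by
    intro n
    rw [mem_closedBall_zero_iff]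
    change ‖y n‖ ≤ _
    have h1 : y n = x + (t : 𝕜) • ∑ i ∈ D n, e i - (x + (t : 𝕜) • ∑ i ∈ D n, e i - y n) := by
      abel
    rw [h1]
    refine (norm_sub_le _ _).trans (add_le_add ((norm_add_le _ _).trans ?_) (hy n))
    rw [htn]
    gcongr
    exact hsumD n
  obtain ⟨a, -, φ, hφ, hlim⟩ := tendsto_subseq_of_bounded Metric.isBounded_closedBall hbd
  obtain ⟨N, hN⟩ := Metric.cauchySeq_iff.1 hlim.cauchySeq δ hδ
  obtain ⟨b, hb⟩ := (insert (d (φ N)) (D (φ N))).exists_nat_subset_range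
  set p := φ N
  set q := φ (max N b) with hq
  have hbq : b ≤ q := (le_max_right N b).trans (hφ.le_apply)
  have hpq : ∀ i ∈ insert (d p) (D p), i ∉ D q := fun i hi hiq =>
    Finset.disjoint_left.1 (hDT q).2 hiq (Finset.range_mono hbq (hb hi))
  refine ⟨D p, D q, d p, hDS p, hDS q, hdS p, hdD p, hpq _ (Finset.mem_insert_self _ _),
    Finset.disjoint_left.2 fun i hi => hpq i (Finset.mem_insert_of_mem hi),
    (hDT p).1.1, (hDT q).1.1, (hdT p).1.1, hWD p, ?_⟩
  have hyy : ‖y p - y q‖ < δ := by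
    have := hN N le_rfl (max N b) (le_max_left _ _)
    rwa [dist_eq_norm] at this
  rw [← htn]
  have h1 : (t : 𝕜) • (∑ i ∈ D p, e i - ∑ i ∈ D q, e i) =
      (x + (t : 𝕜) • ∑ i ∈ D p, e i - y p) - (x + (t : 𝕜) • ∑ i ∈ D q, e i - y q) +
        (y p - y q) := by
    rw [smul_sub]
    abel
  rw [h1]
  refine (norm_add_le _ _).trans ?_
  linarith [norm_sub_le (x + (t : 𝕜) • ∑ i ∈ D p, e i - y p)
    (x + (t : 𝕜) • ∑ i ∈ D q, e i - y q), hy p, hy q]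

/-- The finite dimensional separation property provides an infinite set of indices whose
span is separated from `v`. -/
lemma FDSP.exists_infinite_separated {idx : ℕ → ℕ} (hidx : StrictMono idx) {M : ℝ}
    (hfdsp : FDSP (𝕜 := 𝕜) (fun k => e (idx k)) M) (v : X) {r : ℝ} (hr : 0 < r) :
    ∃ S : Set ℕ, S.Infinite ∧ S ⊆ Set.range idx ∧
      ∀ z ∈ Submodule.span 𝕜 (e '' S), ‖v‖ ≤ (M + r) * ‖v + z‖ := by
  have hsep : TopologicalSpace.IsSeparable (Submodule.span 𝕜 {v} : Set X) :=
    (Set.finite_singleton v).isSeparable.span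
  obtain ⟨k, hk, -, hF⟩ := hfdsp (Submodule.span 𝕜 {v}) (Submodule.closed_of_finiteDimensional _)
    hsep r hr
  obtain ⟨N, hN⟩ := hF _ le_rfl inferInstance
  refine ⟨(fun n => idx (k n)) '' Set.Ioi N,
    (Set.Ioi_infinite N).image (hidx.comp hk).injective.injOn, ?_, fun z hz => ?_⟩
  · rintro _ ⟨n, -, rfl⟩
    exact ⟨k n, rfl⟩
  · refine hN v (Submodule.mem_span_singleton_self v) z (subset_closure ?_)
    refine Submodule.span_mono ?_ hz
    rintro _ ⟨_, ⟨n, hn, rfl⟩, rfl⟩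
    exact ⟨n, hn, rfl⟩

lemma FDSP.one_le {u : ℕ → X} {M : ℝ} (hu : ∀ i, u i ≠ 0) (hfdsp : FDSP (𝕜 := 𝕜) u M) :
    1 ≤ M := by
  refine le_of_forall_pos_le_add fun r hr => ?_
  obtain ⟨k, -, hk, -⟩ := hfdsp ⊥ (by simp)
    (by simpa using (Set.finite_singleton (0 : X)).isSeparable)
    r hr
  have h1 := hk (fun _ => 1) 0 0 le_rfl
  simp only [zero_add, Finset.range_one, Finset.sum_singleton, one_smul] at h1
  have h2 : 0 < ‖u (k 0)‖ := norm_pos_iff.2 (hu _)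
  exact le_of_mul_le_mul_right (by simpa using h1) h2

/-- The main estimate before letting the auxiliary parameter `r` tend to `0`. -/
lemma SemiGreedy.norm_le_approx (hsg : SemiGreedy e f w C s)
    (h : IsMarkushevichBasis e f) (hw : ∀ i, 0 < w i) (hC : 0 < C) (hs0 : 0 < s) (hs1 : s ≤ 1)
    {idx : ℕ → ℕ} (hidx : StrictMono idx) {c : ℝ} (hc : 0 < c) (hcw : ∀ k, c ≤ w (idx k))
    {M : ℝ} (hM : 0 ≤ M) (hfdsp : FDSP (𝕜 := 𝕜) (fun k => e (idx k)) M)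
    (x : X) {A : Finset ℕ} {ε : ℕ → 𝕜} (hε : ∀ i ∈ A, ‖ε i‖ = 1)
    (hA : wsum w (A : Set ℕ) ≤ wsum w {i | 1 ≤ ‖f i x‖}) {r : ℝ} (hr0 : 0 < r) (hr1 : r < 1) :
    ‖∑ i ∈ A, ε i • e i‖ ≤ (M + r) * (C * ((1 + r) * s⁻¹ *
      ((2 * (C * ‖x‖) + r) / ((1 - r) * s ^ 2) + ⨆ i, ‖e i‖))) := by
  obtain ⟨S, hS, hSi, hsep⟩ := hfdsp.exists_infinite_separated hidx (∑ i ∈ A, ε i • e i) hr0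
  have hcS : ∀ i ∈ S, c ≤ w i := by
    intro i hi
    obtain ⟨k, rfl⟩ := hSi hi
    exact hcw k
  have ht : 0 < (1 - r) * s ^ 2 := mul_pos (by linarith) (by positivity)
  have hts : (1 - r) * s ^ 2 < s ^ 2 := by nlinarith [pow_pos hs0 2]
  rw [wsum_coe hw] at hA
  obtain ⟨D, D', d, hDS, hD'S, hdS, hdD, hdD', hDD', hDA, hD'A, hdA, hW, hclose⟩ :=
    hsg.exists_close_blocks h hw hs0 hs1 x ht hts hS hc hcS
      (Finset.sum_nonneg fun i _ => (hw i).le) hA A hr0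
  set η : ℕ → 𝕜 := fun i => if i ∈ D' then -1 else 1 with hη
  set E := insert d D ∪ D' with hE
  have hdisj : Disjoint (insert d D) D' := Finset.disjoint_insert_left.2 ⟨hdD', hDD'⟩
  have hsum : ∑ i ∈ E, η i • e i = (∑ i ∈ D, e i - ∑ i ∈ D', e i) + e d := by
    rw [hE, Finset.sum_union hdisj, Finset.sum_congr rfl (g := fun i => e i) fun i hi => by
        simp [hη, Finset.disjoint_left.1 hdisj hi],
      Finset.sum_congr (s₁ := D') rfl (g := fun i => - e i) fun i hi => by simp [hη, hi],
      Finset.sum_insert hdD, Finset.sum_neg_distrib]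
    abel
  have hES : (E : Set ℕ) ⊆ S := by
    rw [hE, Finset.coe_union, Finset.coe_insert]
    exact Set.union_subset (Set.insert_subset hdS hDS) hD'S
  obtain ⟨y, hyE, hy⟩ := hsg.exists_approx_dominating h hw hs0 (A := A) (E := E) (η := η)
    (Disjoint.symm (Finset.disjoint_union_left.2
      ⟨Finset.disjoint_insert_left.2 ⟨hdA, hDA⟩, hD'A⟩)) hε
    (fun i _ => by simp only [hη]; split_ifs <;> simp)
    (by
      rw [hE, Finset.sum_union hdisj, Finset.sum_insert hdD]
      linarith [Finset.sum_nonneg fun i (_ : i ∈ D') => (hw i).le])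
    (τ := (1 + r) * s⁻¹) (by nlinarith [inv_pos.2 hs0])
  have hsep' := hsep ((((1 + r) * s⁻¹ : ℝ) : 𝕜) • ∑ i ∈ E, η i • e i - y) <|
    Submodule.sub_mem _ (Submodule.smul_mem _ _ <| Submodule.sum_mem _ fun i hi =>
      Submodule.smul_mem _ _ (Submodule.subset_span ⟨i, hES hi, rfl⟩))
      (Submodule.span_mono (Set.image_mono hES) hyE)
  rw [← add_sub_assoc] at hsep'
  refine hsep'.trans ?_
  gcongr
  refine hy.trans ?_
  gcongr
  rw [hsum]
  refine (norm_add_le _ _).trans (add_le_add ?_ (h.norm_e_le d))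
  rw [le_div_iff₀ ht]
  linarith

lemma SemiGreedy.norm_le (hsg : SemiGreedy e f w C s)
    (h : IsMarkushevichBasis e f) (hw : ∀ i, 0 < w i) (hC : 0 < C) (hs0 : 0 < s) (hs1 : s ≤ 1)
    {idx : ℕ → ℕ} (hidx : StrictMono idx) {c : ℝ} (hc : 0 < c) (hcw : ∀ k, c ≤ w (idx k))
    {M : ℝ} (hM : 0 ≤ M) (hfdsp : FDSP (𝕜 := 𝕜) (fun k => e (idx k)) M)
    (x : X) {A : Finset ℕ} {ε : ℕ → 𝕜} (hε : ∀ i ∈ A, ‖ε i‖ = 1)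
    (hA : wsum w (A : Set ℕ) ≤ wsum w {i | 1 ≤ ‖f i x‖}) :
    ‖∑ i ∈ A, ε i • e i‖ ≤
      2 * s⁻¹ * C * M * max ((⨆ i, ‖e i‖) * (⨆ i, ‖f i‖)) (2 * s⁻¹ ^ 2 * C) * ‖x‖ := by
  have hL0 : 0 ≤ ⨆ i, ‖e i‖ := (norm_nonneg _).trans (h.norm_e_le 0)
  have hL0' : 0 ≤ ⨆ i, ‖f i‖ := (norm_nonneg _).trans (h.norm_f_le 0)
  rcases A.eq_empty_or_nonempty with rfl | hAne
  · simp only [Finset.sum_empty, norm_zero]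
    have : 0 ≤ max ((⨆ i, ‖e i‖) * (⨆ i, ‖f i‖)) (2 * s⁻¹ ^ 2 * C) :=
      le_max_of_le_right (by positivity)
    positivity
  have hne : {i | 1 ≤ ‖f i x‖}.Nonempty := by
    by_contra hcon
    rw [Set.not_nonempty_iff_eq_empty] at hcon
    have h0 : wsum w (∅ : Set ℕ) = 0 := by simp [wsum]
    rw [hcon, h0, wsum_coe hw, nonpos_iff_eq_zero, ENNReal.ofReal_eq_zero] at hA
    linarith [Finset.sum_pos (fun i _ => hw i) hAne]
  obtain ⟨i, hi⟩ := hne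
  have hx : 1 ≤ (⨆ i, ‖f i‖) * ‖x‖ :=
    (hi.trans ((f i).le_opNorm x)).trans (by gcongr; exact h.norm_f_le i)
  have hlim : Tendsto (fun r : ℝ => (M + r) * (C * ((1 + r) * s⁻¹ *
      ((2 * (C * ‖x‖) + r) / ((1 - r) * s ^ 2) + ⨆ i, ‖e i‖)))) (nhdsWithin 0 (Set.Ioi 0))
      (nhds ((M + 0) * (C * ((1 + 0) * s⁻¹ *
      ((2 * (C * ‖x‖) + 0) / ((1 - 0) * s ^ 2) + ⨆ i, ‖e i‖))))) := by
    refine Tendsto.mono_left (ContinuousAt.tendsto (x := (0 : ℝ)) ?_) nhdsWithin_le_nhds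
    have : (1 - (0 : ℝ)) * s ^ 2 ≠ 0 := by positivity
    fun_prop (disch := assumption)
  have hle := ge_of_tendsto hlim <| by
    filter_upwards [Ioo_mem_nhdsGT (zero_lt_one (α := ℝ))] with r hr
    exact hsg.norm_le_approx h hw hC hs0 hs1 hidx hc hcw hM hfdsp x hε hA hr.1 hr.2
  refine hle.trans ?_
  set m := max ((⨆ i, ‖e i‖) * (⨆ i, ‖f i‖)) (2 * s⁻¹ ^ 2 * C) with hm
  have h1 : (⨆ i, ‖e i‖) ≤ m * ‖x‖ := by
    calc (⨆ i, ‖e i‖) ≤ (⨆ i, ‖e i‖) * ((⨆ i, ‖f i‖) * ‖x‖) := le_mul_of_one_le_right hL0 hx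
      _ = (⨆ i, ‖e i‖) * (⨆ i, ‖f i‖) * ‖x‖ := by ring
      _ ≤ m * ‖x‖ := by gcongr; exact le_max_left _ _
  have h2 : (2 * (C * ‖x‖) + 0) / ((1 - 0) * s ^ 2) ≤ m * ‖x‖ := by
    calc (2 * (C * ‖x‖) + 0) / ((1 - 0) * s ^ 2) = 2 * s⁻¹ ^ 2 * C * ‖x‖ := by
          field_simp
          ring
      _ ≤ m * ‖x‖ := by gcongr; exact le_max_right _ _
  calc _ ≤ (M + 0) * (C * ((1 + 0) * s⁻¹ * (m * ‖x‖ + m * ‖x‖))) := by gcongr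
    _ = _ := by ring

end

/-- superdemocracy and truncation quasi-greediness of w-semi-greedy bases,
case of a weight subsequence bounded below. -/
theorem statement1 {𝕜 : Type*} [RCLike 𝕜] {X : Type*} [NormedAddCommGroup X]
    [NormedSpace 𝕜 X] [CompleteSpace X]
    (e : ℕ → X) (f : ℕ → X →L[𝕜] 𝕜) (hbasis : IsMarkushevichBasis e f)
    (w : ℕ → ℝ) (hw : ∀ i, 0 < w i)
    (C s : ℝ) (hC : 0 < C) (hs0 : 0 < s) (hs1 : s ≤ 1)
    (hsg : SemiGreedy e f w C s)
    (idx : ℕ → ℕ) (hidx : StrictMono idx)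
    (c : ℝ) (hc : 0 < c) (hcw : ∀ k, c ≤ w (idx k))
    (M : ℝ) (hfdsp : FDSP (𝕜 := 𝕜) (fun k => e (idx k)) M) :
    (∀ (x : X) (A : Finset ℕ) (ε : ℕ → 𝕜), (∀ i ∈ A, ‖ε i‖ = 1) →
      wsum w (A : Set ℕ) ≤ wsum w {i | 1 ≤ ‖f i x‖} →
      ‖∑ i ∈ A, ε i • e i‖ ≤
        2 * s⁻¹ * C * M * max ((⨆ i, ‖e i‖) * (⨆ i, ‖f i‖)) (2 * s⁻¹ ^ 2 * C) * ‖x‖) ∧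
    SuperDemocratic e f w
      (2 * s⁻¹ * C * M * max ((⨆ i, ‖e i‖) * (⨆ i, ‖f i‖)) (2 * s⁻¹ ^ 2 * C)) ∧
    TruncationQuasiGreedy e f
      (2 * s⁻¹ * C * M * max ((⨆ i, ‖e i‖) * (⨆ i, ‖f i‖)) (2 * s⁻¹ ^ 2 * C)) := by
  have hM : 0 ≤ M := zero_le_one.trans <| hfdsp.one_le fun i hi => by
    simpa [hi] using hbasis.biorth (idx i) (idx i)
  have hmain := fun (x : X) (A : Finset ℕ) (ε : ℕ → 𝕜) (hε : ∀ i ∈ A, ‖ε i‖ = 1)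
    (hA : wsum w (A : Set ℕ) ≤ wsum w {i | 1 ≤ ‖f i x‖}) =>
    hsg.norm_le hbasis hw hC hs0 hs1 hidx hc hcw hM hfdsp x hε hA
  refine ⟨hmain, fun A B ε ε' hε hε' hAB => ?_, fun x m A hA hG => ?_⟩
  · refine hmain _ A ε hε (hAB.trans (wsum_mono fun i hi => ?_))
    have hi' : i ∈ B := hi
    rw [Set.mem_ofPred_eq, hbasis.coord_sum, if_pos hi', hε' i hi']
  · set a := A.inf' hA fun i => ‖f i x‖ with ha
    have ha0 : 0 ≤ a := Finset.le_inf' _ _ fun i _ => norm_nonneg _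
    rcases ha0.eq_or_lt with h0 | hpos
    · rw [← h0, zero_mul]
      refine mul_nonneg ?_ (norm_nonneg _)
      have : 0 ≤ max ((⨆ i, ‖e i‖) * (⨆ i, ‖f i‖)) (2 * s⁻¹ ^ 2 * C) :=
        le_max_of_le_right (by positivity)
      positivity
    · have hna : ‖((a⁻¹ : ℝ) : 𝕜)‖ = a⁻¹ := RCLike.norm_of_nonneg (inv_nonneg.2 ha0)
      have := hmain (((a⁻¹ : ℝ) : 𝕜) • x) A (fun i => sgn (f i x)) (fun i _ => norm_sgn _)
        (wsum_mono fun i hi => by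
          rw [Set.mem_ofPred_eq, map_smul, norm_smul, hna, inv_mul_eq_div, one_le_div hpos]
          exact Finset.inf'_le _ hi)
      rw [norm_smul, hna] at this
      calc _ ≤ a * _ := mul_le_mul_of_nonneg_left this ha0
        _ = _ := by field_simp

end GreedyPaper
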